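/- Let A, B ∈ ℂ[t] with A ≠ 0 and deg(A) = n ≥ 3. Suppose p₁, …, p_l ∈ ℂ[t] are pairwise distinct nonzero invariant polynomials (pᵢpᵢ' − pᵢB + A = 0 for each i) with 2l > n + 1 (i.e., l > (n+1)/2). Then there exist α₁, …, α_l ∈ ℂ, not all zero, such that ∑_{i=1}^l αᵢ·(A/pᵢ) = 0 in ℂ[t], where A/pᵢ denotes the exact polynomial quotient; consequently, the Abel equation x' = A(t)x³ + B(t)x² admits a Darboux first integral x^{α₀}·∏_{i=1}^l (1 + pᵢ(t)x)^{αᵢ} with α₀ = −∑ᵢαᵢ. -/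

import Mathlib

open Polynomial

/-- The degrees of two distinct invariant polynomials add up to `deg A + 1`. -/
theorem natDegree_add_natDegree_of_invariant {A B p q : ℂ[X]} (hA : A ≠ 0) (hp0 : p ≠ 0)
    (hq0 : q ≠ 0) (hpq : p ≠ q) (hp : p * derivative p - p * B + A = 0)
    (hq : q * derivative q - q * B + A = 0) :
    p.natDegree + q.natDegree = A.natDegree + 1 := by
  have hd : p - q ≠ 0 := sub_ne_zero.2 hpq
  have key : A * (p - q) = derivative (p - q) * (p * q) := by
    rw [derivative_sub]
    linear_combination p * hq - q * hp
  have hd' : derivative (p - q) ≠ 0 := fun h ↦ mul_ne_zero hA hd (by rw [key, h, zero_mul])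
  have hpos : (p - q).natDegree ≠ 0 := fun h ↦
    hd' (derivative_of_natDegree_zero h)
  have hdeg := congrArg natDegree key
  rw [natDegree_mul hA hd, natDegree_mul hd' (mul_ne_zero hp0 hq0), natDegree_mul hp0 hq0,
    natDegree_derivative] at hdeg
  omega

/-- More than `m` polynomials of degree less than `m` are linearly dependent. -/
theorem exists_sum_C_mul_eq_zero_of_degree_lt {K : Type*} [Field K] {l m : ℕ} (hml : m < l)
    (q : Fin l → K[X]) (hq : ∀ i, (q i).degree < m) :
    ∃ α : Fin l → K, α ≠ 0 ∧ ∑ i, C (α i) * q i = 0 := by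
  let f : Fin l → degreeLT K m := fun i ↦ ⟨q i, mem_degreeLT.2 (hq i)⟩
  have : Module.Finite K (degreeLT K m) := .equiv (degreeLTEquiv K m).symm
  have hf : ¬ LinearIndependent K f := fun h ↦ by
    have := h.fintype_card_le_finrank
    rw [(degreeLTEquiv K m).finrank_eq, Module.finrank_fin_fun, Fintype.card_fin] at this
    omega
  obtain ⟨α, hα, i, hi⟩ := Fintype.not_linearIndependent_iff.1 hf
  refine ⟨α, fun h ↦ hi (congrFun h i), ?_⟩
  simpa [f, smul_eq_C_mul] using congrArg Subtype.val hα

/-- Theorem C: if `n = deg A ≥ 3` and the Abel equation has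
`l > (n+1)/2` pairwise distinct nonzero invariant polynomials, then there is a nontrivial
linear relation `∑ αᵢ (A/pᵢ) = 0` among the cofactors; consequently the Abel equation
admits the Darboux first integral `x^{α₀} ∏ (1 + pᵢ(t)x)^{αᵢ}`, `α₀ = -∑ αᵢ`. -/
theorem abel_darboux_integrability (A B : ℂ[X]) (hA : A ≠ 0) (n : ℕ)
    (hn : A.natDegree = n) (hn3 : 3 ≤ n)
    (l : ℕ) (p : Fin l → ℂ[X]) (hp0 : ∀ i, p i ≠ 0)
    (hpd : ∀ i j, i ≠ j → p i ≠ p j)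
    (hinv : ∀ i, p i * derivative (p i) - p i * B + A = 0)
    (hl : 2 * l > n + 1) :
    ∃ α : Fin l → ℂ, α ≠ 0 ∧ ∑ i, Polynomial.C (α i) * (A / p i) = 0 := by
  have hadd : ∀ i j, i ≠ j → (p i).natDegree + (p j).natDegree = n + 1 := fun i j hij ↦ by
    rw [← hn]
    exact natDegree_add_natDegree_of_invariant hA (hp0 i) (hp0 j) (hpd i j hij) (hinv i) (hinv j)
  have htwo : ∀ i, 2 * (p i).natDegree = n + 1 := fun i ↦ by
    obtain ⟨j, hj⟩ : ∃ j, j ∉ ({i} : Finset (Fin l)) := by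
      by_contra! h
      have := Finset.card_le_card (fun x _ ↦ h x : Finset.univ ⊆ _)
      simp at this
      omega
    obtain ⟨k, hk⟩ : ∃ k, k ∉ ({i, j} : Finset (Fin l)) := by
      by_contra! h
      have := (Finset.card_le_card (fun x _ ↦ h x : Finset.univ ⊆ _)).trans Finset.card_le_two
      simp at this
      omega
    simp only [Finset.mem_insert, Finset.mem_singleton, not_or] at hj hk
    have := hadd i j (Ne.symm hj)
    have := hadd i k (Ne.symm hk.1)
    have := hadd j k (Ne.symm hk.2)
    omega
  refine exists_sum_C_mul_eq_zero_of_degree_lt (m := (n + 1) / 2) (by omega) _ fun i ↦ ?_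
  refine degree_le_natDegree.trans_lt (Nat.cast_lt.2 ?_)
  have hA_eq : A = p i * (B - derivative (p i)) := by linear_combination hinv i
  have hquot : A / p i = B - derivative (p i) := by
    conv_lhs => rw [hA_eq, mul_div_cancel_left₀ _ (hp0 i)]
  have hdeg := congrArg natDegree hA_eq
  rw [natDegree_mul (hp0 i) (right_ne_zero_of_mul (hA_eq ▸ hA)), hn] at hdeg
  rw [hquot]
  have := htwo i
  omega
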